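/- arXiv:1103.3363 — 13 statements merged into one kernel-verified Lean document; each statement's English description precedes it below -/
import Mathlib

section
/- Let $k$ be a field of characteristic different from $2$, let $n \geq 1$, and let $F = (F_1, \ldots, F_n)$ be a polynomial endomorphism of $k^n$ with $\deg(F_i) \leq 2$ for all $i$. Suppose that the determinant of the Jacobian matrix of $F$ is nonzero when evaluated at every point $a \in k^n$. Then the induced map $F : k^n \to k^n$ is injective. -/
open MvPolynomial

/-- The central difference formula, exact for monomials of degree at most two. -/
theorem eval_add_sub_eval_sub_monomial {σ k : Type*} [Fintype σ] [CommRing k]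
    (m d : σ → k) (s : σ →₀ ℕ) (c : k) (hs : s.degree ≤ 2) :
    eval (m + d) (monomial s c) - eval (m - d) (monomial s c) =
      2 * ∑ j, eval m (pderiv j (monomial s c)) * d j := by
  classical
  obtain ⟨t, rfl⟩ := Multiset.toFinsupp.surjective s
  have ht : t.card ≤ 2 := by
    have h := Finsupp.card_toMultiset (Multiset.toFinsupp t)
    rw [Multiset.toFinsupp_toMultiset] at h
    rwa [h]
  interval_cases h : t.card
  · rw [Multiset.card_eq_zero] at h
    subst h
    have h1 : monomial (Multiset.toFinsupp (0 : Multiset σ)) c = C c := by simp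
    rw [h1]
    simp
  · obtain ⟨i, rfl⟩ := Multiset.card_eq_one.1 h
    have h1 : monomial (Multiset.toFinsupp {i}) c = C c * X i := by
      rw [Multiset.toFinsupp_singleton, C_mul_X_eq_monomial]
    rw [h1]
    simp [pderiv_X, Pi.single_apply, apply_ite (eval m), ite_mul]
    ring
  · obtain ⟨i, j, rfl⟩ := Multiset.card_eq_two.1 h
    have h1 : monomial (Multiset.toFinsupp {i, j}) c = C c * X i * X j := by
      rw [Multiset.insert_eq_cons, ← Multiset.singleton_add, map_add,
        Multiset.toFinsupp_singleton, Multiset.toFinsupp_singleton, C_mul_X_eq_monomial, X,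
        monomial_mul, mul_one]
    rw [h1]
    simp [pderiv_X, Pi.single_apply, apply_ite (eval m), ite_mul, add_mul, Finset.sum_add_distrib]
    ring

/-- The central difference formula, exact for polynomials of degree at most two. -/
theorem eval_add_sub_eval_sub_of_totalDegree_le_two {σ k : Type*} [Fintype σ] [CommRing k]
    (m d : σ → k) (p : MvPolynomial σ k) (hp : p.totalDegree ≤ 2) :
    eval (m + d) p - eval (m - d) p = 2 * ∑ j, eval m (pderiv j p) * d j := by
  have key : ∑ s ∈ p.support, (eval (m + d) (monomial s (p.coeff s)) -
      eval (m - d) (monomial s (p.coeff s))) =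
      ∑ s ∈ p.support, 2 * ∑ j, eval m (pderiv j (monomial s (p.coeff s))) * d j :=
    Finset.sum_congr rfl fun s hs =>
      eval_add_sub_eval_sub_monomial m d s _ ((le_totalDegree hs).trans hp)
  rw [Finset.sum_sub_distrib, ← map_sum, ← map_sum, ← p.as_sum, ← Finset.mul_sum,
    Finset.sum_comm] at key
  simpa only [← Finset.sum_mul, ← map_sum, ← p.as_sum] using key

theorem degree_two_nowhere_vanishing_jacobian_injective
    {k : Type*} [Field k] (hchar : ringChar k ≠ 2) (n : ℕ) (hn : 1 ≤ n)
    (F : Fin n → MvPolynomial (Fin n) k)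
    (hdeg : ∀ i, (F i).totalDegree ≤ 2)
    (hjac : ∀ a : Fin n → k,
      eval a (Matrix.det (Matrix.of fun i j => pderiv j (F i))) ≠ 0) :
    Function.Injective (fun a : Fin n → k => fun i => eval a (F i)) := by
  intro a b hab
  have h2 : (2 : k) ≠ 0 := Ring.two_ne_zero hchar
  set m : Fin n → k := fun i => (a i + b i) / 2 with hm
  set d : Fin n → k := fun i => (a i - b i) / 2 with hd
  have hma : m + d = a := by
    ext i
    simp only [hm, hd, Pi.add_apply]
    field_simp
    ring
  have hmb : m - d = b := by
    ext i
    simp only [hm, hd, Pi.sub_apply]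
    field_simp
    ring
  have hdet := hjac m
  rw [RingHom.map_det] at hdet
  have hd0 : d = 0 := by
    refine Matrix.eq_zero_of_mulVec_eq_zero hdet ?_
    ext i
    have h := eval_add_sub_eval_sub_of_totalDegree_le_two m d (F i) (hdeg i)
    rw [hma, hmb, sub_eq_zero.2 (congrFun hab i)] at h
    exact (mul_eq_zero.1 h.symm).resolve_left h2
  rw [← hma, ← hmb, hd0, add_zero, sub_zero]
end

section
/- Let $k$ be a finite field of characteristic different from $2$, let $n \geq 1$, and let $F = (F_1, \ldots, F_n)$ be a polynomial endomorphism of $k^n$ with $\deg(F_i) \leq 2$ for all $i$. Suppose that the determinant of the Jacobian matrix of $F$ equals the constant polynomial $1$. Then $F$ is a polynomial automorphism of $k^n$; that is, there exists a polynomial endomorphism $G = (G_1, \ldots, G_n)$ of $k^n$ such that $F \circ G = G \circ F = (X_1, \ldots, X_n)$, where composition means substitution of the components of one tuple into the other. -/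
open MvPolynomial

open scoped Matrix TensorProduct

namespace MvPolynomial

variable {σ τ k R : Type*} [Field k] [CommRing R] [Algebra k R]

/-- The first-order Taylor formula along a displacement whose coordinates have vanishing
products. -/
theorem aeval_add_of_mul_eq_zero [Fintype σ] (r d : σ → R) (hd : ∀ i j, d i * d j = 0)
    (p : MvPolynomial σ k) :
    aeval (r + d) p = aeval r p + ∑ j, aeval r (pderiv j p) * d j := by
  classical
  induction p using MvPolynomial.induction_on with
  | C a => simp
  | add p q hp hq =>
    simp only [map_add, hp, hq, add_mul, Finset.sum_add_distrib]
    ring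
  | mul_X p i hp =>
    have h : (∑ j, aeval r (pderiv j p) * d j) * d i = 0 := by
      simp [Finset.sum_mul, mul_assoc, hd]
    have h' : ∑ j, aeval r (pderiv j (p * X i)) * d j =
        aeval r p * d i + r i * ∑ j, aeval r (pderiv j p) * d j := by
      simp only [pderiv_mul, map_add, map_mul, aeval_X, add_mul, Finset.sum_add_distrib,
        pderiv_X, Finset.mul_sum]
      rw [add_comm]
      congr 1
      · rw [Finset.sum_eq_single i] <;> simp +contextual [eq_comm]
      · exact Finset.sum_congr rfl fun j _ ↦ by ring
    rw [h']
    simp only [map_mul, aeval_X, hp, Pi.add_apply]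
    linear_combination h

/-- An induction principle for polynomials of total degree at most two. -/
theorem induction_on_totalDegree_le_two {P : MvPolynomial σ k → Prop}
    (hC : ∀ a, P (C a)) (hX : ∀ a i, P (C a * X i)) (hXX : ∀ a i j, P (C a * (X i * X j)))
    (hadd : ∀ p q, P p → P q → P (p + q)) (p : MvPolynomial σ k) (hp : p.totalDegree ≤ 2) :
    P p := by
  classical
  rw [p.as_sum]
  refine Finset.sum_induction _ P hadd (by simpa using hC 0) fun s hs ↦ ?_
  have hcard : Multiset.card s.toMultiset ≤ 2 := by
    rw [Finsupp.card_toMultiset]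
    exact (le_totalDegree hs).trans hp
  obtain ⟨m, rfl⟩ := Multiset.toFinsupp.surjective s
  rw [Multiset.toFinsupp_toMultiset] at hcard
  generalize coeff (Multiset.toFinsupp m) p = a
  obtain h | h | h : m.card = 0 ∨ m.card = 1 ∨ m.card = 2 := by omega
  · obtain rfl := Multiset.card_eq_zero.mp h
    simpa using hC a
  · obtain ⟨i, rfl⟩ := Multiset.card_eq_one.mp h
    have := hX a i
    rwa [X, C_mul_monomial, mul_one, ← Multiset.toFinsupp_singleton] at this
  · obtain ⟨i, j, rfl⟩ := Multiset.card_eq_two.mp h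
    have := hXX a i j
    rwa [X, X, monomial_mul, C_mul_monomial, mul_one, mul_one, ← Multiset.toFinsupp_singleton,
      ← Multiset.toFinsupp_singleton, ← Multiset.toFinsupp_add, Multiset.singleton_add] at this

/-- The midpoint formula for differences of values, exact in degree at most two. -/
theorem aeval_add_sub_aeval_sub [Fintype σ] (r d : σ → R) (p : MvPolynomial σ k)
    (hp : p.totalDegree ≤ 2) :
    aeval (r + d) p - aeval (r - d) p = 2 * ∑ j, aeval r (pderiv j p) * d j := by
  classical
  have hX (i : σ) : ∑ j, aeval r (pderiv j (X i : MvPolynomial σ k)) * d j = d i := by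
    simp [pderiv_X, Pi.single_apply, apply_ite (aeval r)]
  have hmul (p q : MvPolynomial σ k) : ∑ j, aeval r (pderiv j (p * q)) * d j =
      (∑ j, aeval r (pderiv j p) * d j) * aeval r q +
        aeval r p * ∑ j, aeval r (pderiv j q) * d j := by
    simp only [pderiv_mul, map_add, map_mul, add_mul, Finset.sum_add_distrib, Finset.mul_sum,
      Finset.sum_mul]
    congr 1 <;> exact Finset.sum_congr rfl fun j _ ↦ by ring
  refine induction_on_totalDegree_le_two (P := fun p ↦ aeval (r + d) p - aeval (r - d) p =
    2 * ∑ j, aeval r (pderiv j p) * d j) ?_ ?_ ?_ ?_ p hp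
  · intro a
    simp
  · intro a i
    rw [hmul, hX]
    simp
    ring
  · intro a i j
    rw [hmul, hmul, hX, hX]
    simp
    ring
  · intro p q hp hq
    simp only [map_add, add_mul, Finset.sum_add_distrib]
    linear_combination hp + hq

/-- A quadratic system whose Jacobian matrix has a left inverse is injective on points with
values in any algebra over a field of characteristic different from two. -/
theorem aeval_injective_of_totalDegree_le_two [Fintype σ] [DecidableEq σ] [Fintype τ]
    (h2 : (2 : k) ≠ 0) {F : τ → MvPolynomial σ k} (hdeg : ∀ i, (F i).totalDegree ≤ 2)
    {M : Matrix σ τ (MvPolynomial σ k)} (hM : M * Matrix.of (fun i j ↦ pderiv j (F i)) = 1) :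
    Function.Injective fun (x : σ → R) i ↦ aeval x (F i) := by
  intro x y hxy
  have h2R : algebraMap k R 2⁻¹ * 2 = 1 := by
    rw [← map_ofNat (algebraMap k R) 2, ← map_mul, inv_mul_cancel₀ h2, map_one]
  set c : R := algebraMap k R 2⁻¹
  set m : σ → R := c • (x + y)
  set d : σ → R := c • (x - y)
  have hx : m + d = x := by
    ext i; simp only [m, d, Pi.add_apply, Pi.sub_apply, Pi.smul_apply, smul_eq_mul]
    linear_combination x i * h2R
  have hy : m - d = y := by
    ext i; simp only [m, d, Pi.add_apply, Pi.sub_apply, Pi.smul_apply, smul_eq_mul]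
    linear_combination y i * h2R
  have hJ (i : τ) : ∑ j, aeval m (pderiv j (F i)) * d j = 0 := by
    have h := aeval_add_sub_aeval_sub m d (F i) (hdeg i)
    rw [hx, hy, show aeval x (F i) = aeval y (F i) from congr_fun hxy i, sub_self] at h
    linear_combination (-(∑ j, aeval m (pderiv j (F i)) * d j)) * h2R - c * h
  have hd : d = 0 := by
    have h : (M * Matrix.of fun i j ↦ pderiv j (F i)).map (aeval m) = 1 := by simp [hM]
    rw [Matrix.map_mul] at h
    rw [← Matrix.one_mulVec d, ← h, ← Matrix.mulVec_mulVec]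
    have hJ' : (Matrix.of fun i j ↦ pderiv j (F i)).map (aeval m) *ᵥ d = 0 :=
      _root_.funext hJ
    rw [hJ', Matrix.mulVec_zero]
  rw [← hx, ← hy, hd, add_zero, sub_zero]

section Endomorphism

variable {F : τ → MvPolynomial σ k} [Algebra (MvPolynomial τ k) (MvPolynomial σ k)]
  [IsScalarTower k (MvPolynomial τ k) (MvPolynomial σ k)]

/-- A polynomial map whose Jacobian matrix has a right inverse is formally smooth. -/
theorem formallySmooth_of_jacobian_mul_eq_one [Fintype σ] [Fintype τ] [DecidableEq τ]
    (hF : ∀ i, algebraMap (MvPolynomial τ k) (MvPolynomial σ k) (X i) = F i)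
    {M : Matrix σ τ (MvPolynomial σ k)} (hM : Matrix.of (fun i j ↦ pderiv j (F i)) * M = 1) :
    Algebra.FormallySmooth (MvPolynomial τ k) (MvPolynomial σ k) := by
  refine .of_comp_surjective fun S _ _ I hI g ↦ ?_
  let _ : Algebra k S := Algebra.compHom S (algebraMap k (MvPolynomial τ k))
  have : IsScalarTower k (MvPolynomial τ k) S := .of_algebraMap_eq' rfl
  choose r hr using fun j ↦ Ideal.Quotient.mk_surjective (g (X j))
  have hg : (Ideal.Quotient.mkₐ k I).comp (aeval r) = g.restrictScalars k := by
    ext j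
    simp [hr]
  set e : τ → S := fun i ↦ algebraMap (MvPolynomial τ k) S (X i) - aeval r (F i)
  have he (i : τ) : e i ∈ I := by
    rw [← Ideal.Quotient.eq_zero_iff_mem, map_sub, sub_eq_zero]
    have h := DFunLike.congr_fun hg (F i)
    simp only [AlgHom.comp_apply, Ideal.Quotient.mkₐ_eq_mk, AlgHom.restrictScalars_apply] at h
    rw [h, ← hF, g.commutes]
    rfl
  set d : σ → S := M.map (aeval r) *ᵥ e
  have hd (j : σ) : d j ∈ I := Ideal.sum_mem _ fun i _ ↦ I.mul_mem_left _ (he i)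
  have hdd (i j : σ) : d i * d j = 0 := by
    rw [← Ideal.mem_bot, ← hI, sq]
    exact Ideal.mul_mem_mul (hd i) (hd j)
  have hJ : (Matrix.of fun i j ↦ pderiv j (F i)).map (aeval r) *ᵥ d = e := by
    have h : (Matrix.of (fun i j ↦ pderiv j (F i)) * M).map (aeval r) = 1 := by simp [hM]
    rw [Matrix.map_mul] at h
    rw [Matrix.mulVec_mulVec, h, Matrix.one_mulVec]
  have hφ : ((aeval (r + d)).comp (IsScalarTower.toAlgHom k _ _) : MvPolynomial τ k →ₐ[k] S) =
      IsScalarTower.toAlgHom k _ _ := by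
    ext i
    have h : ∑ j, aeval r (pderiv j (F i)) * d j = e i := congr_fun hJ i
    simp [hF, aeval_add_of_mul_eq_zero r d hdd, h, e]
  refine ⟨{ aeval (r + d) with commutes' := DFunLike.congr_fun hφ }, ?_⟩
  apply AlgHom.restrictScalars_injective k
  ext j
  have := Ideal.Quotient.eq_zero_iff_mem.mpr (hd j)
  simp [hr, this]

/-- Over a finite field, a polynomial map between spaces of equal dimension which is injective on
points with values in finite extensions hits every maximal ideal. -/
theorem exists_ideal_comap_eq_of_injective [Finite k] [Finite σ] [Finite τ]
    (hF : ∀ i, algebraMap (MvPolynomial τ k) (MvPolynomial σ k) (X i) = F i)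
    (hcard : Nat.card σ = Nat.card τ)
    (hinj : ∀ (m : Ideal (MvPolynomial τ k)), m.IsMaximal →
      Function.Injective fun (x : σ → MvPolynomial τ k ⧸ m) i ↦ aeval x (F i))
    (m : Ideal (MvPolynomial τ k)) (hm : m.IsMaximal) :
    ∃ P : Ideal (MvPolynomial σ k), P ≠ ⊤ ∧ P.comap (algebraMap (MvPolynomial τ k) _) = m := by
  let _ := Ideal.Quotient.field m
  have := finite_of_finite_type_of_isJacobsonRing k (MvPolynomial τ k ⧸ m)
  have := Module.finite_of_finite k (M := MvPolynomial τ k ⧸ m)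
  have hsurj := ((Nat.bijective_iff_injective_and_card _).mpr ⟨hinj m hm, by
    rw [Nat.card_fun, Nat.card_fun, hcard]⟩).surjective
  obtain ⟨x, hx⟩ := hsurj fun i ↦ Ideal.Quotient.mk m (X i)
  have h : ((aeval x).comp (IsScalarTower.toAlgHom k (MvPolynomial τ k) (MvPolynomial σ k))) =
      Ideal.Quotient.mkₐ k m := by
    ext i
    simpa [hF] using congr_fun hx i
  refine ⟨RingHom.ker (aeval x : MvPolynomial σ k →ₐ[k] _), RingHom.ker_ne_top _, ?_⟩
  ext p
  have := DFunLike.congr_fun h p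
  simp only [AlgHom.comp_apply, IsScalarTower.coe_toAlgHom', Ideal.Quotient.mkₐ_eq_mk] at this
  rw [Ideal.mem_comap, RingHom.mem_ker, this, Ideal.Quotient.eq_zero_iff_mem]

/-- A faithfully flat polynomial map that is injective on points is bijective. -/
theorem algebraMap_bijective_of_injective
    (hF : ∀ i, algebraMap (MvPolynomial τ k) (MvPolynomial σ k) (X i) = F i)
    [Module.FaithfullyFlat (MvPolynomial τ k) (MvPolynomial σ k)]
    (hinj : Function.Injective fun
      (x : σ → MvPolynomial σ k ⊗[MvPolynomial τ k] MvPolynomial σ k) i ↦ aeval x (F i)) :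
    Function.Bijective (algebraMap (MvPolynomial τ k) (MvPolynomial σ k)) := by
  refine ⟨FaithfulSMul.algebraMap_injective _ _,
    Module.FaithfullyFlat.surjective_of_tensorProduct (S := MvPolynomial σ k) ?_⟩
  let l : MvPolynomial σ k →ₐ[k] MvPolynomial σ k ⊗[MvPolynomial τ k] MvPolynomial σ k :=
    Algebra.TensorProduct.includeLeft
  let r : MvPolynomial σ k →ₐ[k] MvPolynomial σ k ⊗[MvPolynomial τ k] MvPolynomial σ k :=
    (Algebra.TensorProduct.includeRight (R := MvPolynomial τ k)).restrictScalars k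
  have hlr : l = r := by
    have h (f : MvPolynomial σ k →ₐ[k] MvPolynomial σ k ⊗[MvPolynomial τ k] MvPolynomial σ k) :
        f = aeval fun j ↦ f (X j) := by ext; simp
    rw [h l, h r]
    congr 1
    apply hinj
    funext i
    beta_reduce
    rw [← h l, ← h r, ← hF]
    simp [l, r]
  intro z
  induction z with
  | zero => exact ⟨0, map_zero _⟩
  | add x y hx hy =>
    obtain ⟨a, rfl⟩ := hx
    obtain ⟨b, rfl⟩ := hy
    exact ⟨a + b, map_add _ _ _⟩
  | tmul a b =>
    refine ⟨a * b, ?_⟩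
    have h : b ⊗ₜ[MvPolynomial τ k] (1 : MvPolynomial σ k) = 1 ⊗ₜ b := DFunLike.congr_fun hlr b
    rw [map_mul, Algebra.TensorProduct.algebraMap_apply, Algebra.TensorProduct.algebraMap_apply]
    simp [h]

end Endomorphism

/-- A quadratic polynomial map over a finite field of odd characteristic with invertible Jacobian
matrix induces an isomorphism of polynomial rings. -/
theorem aeval_bijective_of_totalDegree_le_two [Finite k] [Fintype σ] [DecidableEq σ] [Fintype τ]
    [DecidableEq τ] (hcard : Nat.card σ = Nat.card τ) (h2 : (2 : k) ≠ 0)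
    {F : τ → MvPolynomial σ k} (hdeg : ∀ i, (F i).totalDegree ≤ 2)
    {M : Matrix σ τ (MvPolynomial σ k)}
    (hMJ : M * Matrix.of (fun i j ↦ pderiv j (F i)) = 1)
    (hJM : Matrix.of (fun i j ↦ pderiv j (F i)) * M = 1) :
    Function.Bijective (aeval F : MvPolynomial τ k →ₐ[k] MvPolynomial σ k) := by
  let _ : Algebra (MvPolynomial τ k) (MvPolynomial σ k) := (aeval F).toAlgebra
  have : IsScalarTower k (MvPolynomial τ k) (MvPolynomial σ k) := .of_algHom (aeval F)
  have hF (i : τ) : algebraMap (MvPolynomial τ k) (MvPolynomial σ k) (X i) = F i :=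
    aeval_X F i
  have : Algebra.FormallySmooth (MvPolynomial τ k) (MvPolynomial σ k) :=
    formallySmooth_of_jacobian_mul_eq_one hF hJM
  have : Algebra.FinitePresentation (MvPolynomial τ k) (MvPolynomial σ k) :=
    .of_restrict_scalars_finitePresentation k _ _
  have : Algebra.Smooth (MvPolynomial τ k) (MvPolynomial σ k) := {}
  have : Module.FaithfullyFlat (MvPolynomial τ k) (MvPolynomial σ k) :=
    { submodule_ne_top := by
        intro m hm h
        obtain ⟨P, hP, rfl⟩ := exists_ideal_comap_eq_of_injective hF hcard
          (fun _ _ ↦ aeval_injective_of_totalDegree_le_two h2 hdeg hMJ) m hm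
        refine hP (Ideal.eq_top_iff_one _ |>.mpr ?_)
        rw [Ideal.smul_top_eq_map] at h
        have h1 : (1 : MvPolynomial σ k) ∈ Submodule.restrictScalars (MvPolynomial τ k)
            ((P.comap (algebraMap (MvPolynomial τ k) (MvPolynomial σ k))).map
              (algebraMap (MvPolynomial τ k) (MvPolynomial σ k))) := h ▸ Submodule.mem_top
        exact Ideal.map_comap_le h1 }
  exact algebraMap_bijective_of_injective hF (aeval_injective_of_totalDegree_le_two h2 hdeg hMJ)

end MvPolynomial

theorem degree_two_jacobian_one_automorphism
    {k : Type*} [Field k] [Fintype k] (hchar : ringChar k ≠ 2) (n : ℕ) (hn : 1 ≤ n)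
    (F : Fin n → MvPolynomial (Fin n) k)
    (hdeg : ∀ i, (F i).totalDegree ≤ 2)
    (hjac : Matrix.det (Matrix.of fun i j => pderiv j (F i)) = 1) :
    ∃ G : Fin n → MvPolynomial (Fin n) k,
      (∀ i, aeval G (F i) = X i) ∧ (∀ i, aeval F (G i) = X i) := by
  have hinv : IsUnit (Matrix.of fun i j ↦ pderiv j (F i)).det := by simp [hjac]
  let e := AlgEquiv.ofBijective (aeval F : MvPolynomial (Fin n) k →ₐ[k] _) <|
    aeval_bijective_of_totalDegree_le_two rfl (Ring.two_ne_zero hchar) hdeg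
      (Matrix.nonsing_inv_mul _ hinv) (Matrix.mul_nonsing_inv _ hinv)
  refine ⟨fun i ↦ e.symm (X i), fun i ↦ ?_, fun i ↦ e.apply_symm_apply (X i)⟩
  have h : aeval (R := k) (fun i ↦ e.symm (X i)) = (e.symm : MvPolynomial (Fin n) k →ₐ[k] _) := by
    ext
    simp
  rw [h]
  exact e.symm_apply_eq.mpr (aeval_X F i).symm
end

section
/- Let $k$ be a finite field and let $a, b \in k$ be nonzero elements such that $ab$ is not a square in $k$. Let $F = (X_1, \; X_2 + a X_1 X_3, \; X_3 + b X_1 X_2)$ be the polynomial endomorphism of $k^3$. Then the determinant of the Jacobian matrix of $F$ equals the polynomial $1 - a b X_1^2$, this determinant is nonzero when evaluated at every point of $k^3$, and yet $F$ is not a polynomial automorphism of $k^3$. -/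
open MvPolynomial

theorem nowhere_vanishing_jacobian_not_automorphism_example
    {k : Type*} [Field k] [Fintype k] (a b : k) (ha : a ≠ 0) (hb : b ≠ 0)
    (hab : ¬ ∃ t : k, a * b = t ^ 2)
    (F : Fin 3 → MvPolynomial (Fin 3) k)
    (hF : F = ![X 0, X 1 + C a * X 0 * X 2, X 2 + C b * X 0 * X 1]) :
    Matrix.det (Matrix.of fun i j => pderiv j (F i)) = 1 - C a * C b * X 0 ^ 2 ∧
    (∀ p : Fin 3 → k,
      eval p (Matrix.det (Matrix.of fun i j => pderiv j (F i))) ≠ 0) ∧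
    ¬ ∃ G : Fin 3 → MvPolynomial (Fin 3) k,
        (∀ i, aeval G (F i) = X i) ∧ (∀ i, aeval F (G i) = X i) := by
  have hdet : Matrix.det (Matrix.of fun i j => pderiv j (F i)) = 1 - C a * C b * X 0 ^ 2 := by
    subst hF
    simp [Matrix.det_fin_three, pderiv_X]
    ring
  refine ⟨hdet, fun p hp => ?_, ?_⟩
  · rw [hdet] at hp
    simp only [map_sub, map_mul, map_pow, map_one, eval_C, eval_X] at hp
    exact hab ⟨a * b * p 0, by linear_combination (a * b) * hp⟩
  · rintro ⟨G, hG, -⟩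
    subst hF
    have h0 : G 0 = X 0 := by simpa using hG 0
    have h1 : G 1 + C a * X 0 * G 2 = X 1 := by simpa [h0, algebraMap_eq] using hG 1
    have h2 : G 2 + C b * X 0 * G 1 = X 2 := by simpa [h0, algebraMap_eq] using hG 2
    have h : G 1 * (1 - C a * C b * X 0 ^ 2) = X 1 - C a * X 0 * X 2 := by
      linear_combination h1 - C a * X 0 * h2
    -- Over the algebraic closure, the factor `1 - a b X₀²` has a root `s`.
    obtain ⟨s, hs⟩ := IsAlgClosed.exists_pow_nat_eq
      (algebraMap k (AlgebraicClosure k) (a * b)⁻¹) two_pos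
    have hs' : algebraMap k (AlgebraicClosure k) a * algebraMap k (AlgebraicClosure k) b * s ^ 2
        = 1 := by
      rw [hs, ← map_mul, ← map_mul, mul_inv_cancel₀ (mul_ne_zero ha hb), map_one]
    have he := congrArg (aeval ![s, 1, 0]) h
    simp [hs'] at he
end

section
/- Let $k$ be a finite field, $n \geq 1$, and let $F$ be a polynomial automorphism of $k^n$ that is locally finite, meaning there exists $d \in \mathbb{N}$ such that every component of every iterate $F^{\circ m}$ ($m \in \mathbb{N}$) has total degree at most $d$. Then $F$ has finite order: there exists $m \geq 1$ such that $F^{\circ m} = (X_1, \ldots, X_n)$. -/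
open MvPolynomial

/-- Composition of polynomial endomorphisms: `(endoComp F G) i = F i (G 1, …, G n)`. -/
noncomputable def endoComp {k : Type*} [Field k] {n : ℕ}
    (F G : Fin n → MvPolynomial (Fin n) k) : Fin n → MvPolynomial (Fin n) k :=
  fun i => aeval G (F i)

/-- Iterated composition of a polynomial endomorphism with itself;
`endoIter F 0 = (X 1, …, X n)`. -/
noncomputable def endoIter {k : Type*} [Field k] {n : ℕ}
    (F : Fin n → MvPolynomial (Fin n) k) : ℕ → Fin n → MvPolynomial (Fin n) k
  | 0 => fun i => X i
  | m + 1 => endoComp F (endoIter F m)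

/-- The algebra endomorphism attached to the `m`-th iterate of `F` is the `m`-th power of the one
attached to `F`. -/
theorem aeval_endoIter {k : Type*} [Field k] {n : ℕ}
    (F : Fin n → MvPolynomial (Fin n) k) (m : ℕ) :
    (aeval (endoIter F m) : MvPolynomial (Fin n) k →ₐ[k] MvPolynomial (Fin n) k) =
      aeval F ^ m := by
  induction m with
  | zero =>
    ext1 i
    simp [endoIter]
  | succ m ih =>
    ext1 i
    rw [aeval_X, pow_succ, ← ih, AlgHom.mul_apply, aeval_X]
    rfl

/-- Over a finite ring there are only finitely many polynomials of bounded total degree in finitely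
many variables. -/
theorem finite_setOf_totalDegree_le (σ k : Type*) [Finite σ] [CommRing k] [Finite k] (d : ℕ) :
    {p : MvPolynomial σ k | p.totalDegree ≤ d}.Finite := by
  have : Finite (restrictTotalDegree σ k d) := Module.finite_of_finite k
  refine (Set.toFinite (restrictTotalDegree σ k d : Set (MvPolynomial σ k))).subset ?_
  exact fun p hp => (mem_restrictTotalDegree σ d p).2 hp

theorem locally_finite_automorphism_finite_order
    {k : Type*} [Field k] [Fintype k] (n : ℕ) (hn : 1 ≤ n)
    (F : Fin n → MvPolynomial (Fin n) k)
    (haut : ∃ G : Fin n → MvPolynomial (Fin n) k,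
      (∀ i, aeval G (F i) = X i) ∧ (∀ i, aeval F (G i) = X i))
    (hlf : ∃ d : ℕ, ∀ m : ℕ, ∀ i, (endoIter F m i).totalDegree ≤ d) :
    ∃ m : ℕ, 1 ≤ m ∧ ∀ i, endoIter F m i = X i := by
  obtain ⟨G, hGF, hFG⟩ := haut
  obtain ⟨d, hd⟩ := hlf
  let φ : MvPolynomial (Fin n) k →ₐ[k] MvPolynomial (Fin n) k := aeval F
  have hφ : IsUnit φ := by
    refine ⟨⟨φ, aeval G, ?_, ?_⟩, rfl⟩
    · ext1 i
      simpa [φ, AlgHom.mul_apply] using hFG i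
    · ext1 i
      simpa [φ, AlgHom.mul_apply] using hGF i
  have hfin : (Set.univ.pi fun _ : Fin n =>
      {p : MvPolynomial (Fin n) k | p.totalDegree ≤ d}).Finite :=
    Set.Finite.pi fun _ => finite_setOf_totalDegree_le (Fin n) k d
  obtain ⟨a, b, hab, h⟩ := hfin.exists_lt_map_eq_of_forall_mem
    (Set.mem_univ_pi.2 <| hd ·)
  have hpow : φ ^ a = φ ^ b := by
    rw [← aeval_endoIter, ← aeval_endoIter, h]
  have hone : φ ^ (b - a) = 1 := by
    refine (hφ.pow a).mul_left_cancel ?_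
    rw [← pow_add, Nat.add_sub_cancel' hab.le, mul_one, hpow]
  refine ⟨b - a, Nat.sub_pos_of_lt hab, fun i => ?_⟩
  rw [← aeval_X (R := k) (endoIter F (b - a)) i, aeval_endoIter, hone, AlgHom.one_apply]
end

section
/- Let $r \geq 1$ and suppose $3 \nmid r$. Then the map $x \mapsto x^4 + x^2 + x$ is a bijection of the finite field $\mathbb{F}_{2^r}$ with $2^r$ elements. -/
/-- In characteristic two, a root of `x ^ 4 + x ^ 2 + x` fixed by the `r`-th power of Frobenius
with `3 ∤ r` vanishes. -/
theorem eq_zero_of_x4_add_x2_add_x_eq_zero {K : Type*} [CommRing K] [IsReduced K] [CharP K 2]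
    {r : ℕ} (h3 : ¬ 3 ∣ r) {x : K} (hx : x ^ 2 ^ r = x) (h : x ^ 4 + x ^ 2 + x = 0) : x = 0 := by
  have h2 : (2 : K) = 0 := CharTwo.two_eq_zero
  have h8 : x ^ 8 = x := by
    linear_combination (x ^ 4 + x ^ 2 + x - 1) * h - (x ^ 6 + x ^ 5 + x ^ 3) * h2
  have h8k (k : ℕ) : x ^ 8 ^ k = x := by
    induction k with
    | zero => simp
    | succ k ih => rw [pow_succ, pow_mul, ih, h8]
  have hpow : x ^ 2 ^ (r % 3) = x := by
    rw [← Nat.div_add_mod r 3, pow_add, pow_mul, pow_mul] at hx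
    simpa [h8k] using hx
  obtain hr | hr : r % 3 = 1 ∨ r % 3 = 2 := by omega
  · have hsq : x ^ 2 = x := by simpa [hr] using hpow
    linear_combination h - (x ^ 2 + x + 2) * hsq - x * h2
  · have hfour : x ^ 4 = x := by simpa [hr] using hpow
    have hsq : x ^ 2 = 0 := by linear_combination h - hfour - x * h2
    exact pow_eq_zero_iff two_ne_zero |>.mp hsq

theorem bijective_x4_x2_x (r : ℕ) (hr : 1 ≤ r) (h3 : ¬ (3 ∣ r)) :
    Function.Bijective (fun x : GaloisField 2 r => x ^ 4 + x ^ 2 + x) := by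
  refine Finite.injective_iff_bijective.mp fun a b hab => sub_eq_zero.mp ?_
  have h2 : (2 : GaloisField 2 r) = 0 := CharTwo.two_eq_zero
  refine eq_zero_of_x4_add_x2_add_x_eq_zero h3 ?_ ?_
  · have := Fintype.ofFinite (GaloisField 2 r)
    rw [← GaloisField.card 2 r (by omega), Nat.card_eq_fintype_card, FiniteField.pow_card]
  · linear_combination hab + (-2 * a ^ 3 * b + 3 * a ^ 2 * b ^ 2 - 2 * a * b ^ 3 + b ^ 4
      - a * b + b ^ 2) * h2
end

section
/- Let $r \geq 1$ and suppose $7 \nmid r$. Then the map $x \mapsto x^8 + x^4 + x$ is a bijection of the finite field $\mathbb{F}_{2^r}$ with $2^r$ elements. -/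
/-- In characteristic two, a root of `x ^ 8 + x ^ 4 + x` is fixed by the seventh power of the
Frobenius, since `t ^ 3 + t ^ 2 + 1` divides `t ^ 7 + 1` over the field with two elements. -/
lemma pow_128_eq_self_of_x8_x4_x_eq_zero {R : Type*} [CommRing R] [CharP R 2] {x : R}
    (hx : x ^ 8 + x ^ 4 + x = 0) : x ^ 128 = x := by
  have h8 : x ^ 8 = x ^ 4 + x := by
    rw [← CharTwo.add_eq_zero, ← hx, add_assoc]
  have sq_add {a b c : R} (h : a = b + c) : a ^ 2 = b ^ 2 + c ^ 2 := by
    rw [h, CharTwo.add_sq]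
  have h16 : x ^ 16 = x ^ 8 + x ^ 2 := by simpa only [← pow_mul] using sq_add h8
  have h32 : x ^ 32 = x ^ 16 + x ^ 4 := by simpa only [← pow_mul] using sq_add h16
  have h64 : x ^ 64 = x ^ 32 + x ^ 8 := by simpa only [← pow_mul] using sq_add h32
  have h128 : x ^ 128 = x ^ 64 + x ^ 16 := by simpa only [← pow_mul] using sq_add h64
  have h2 : (2 : R) = 0 := CharTwo.two_eq_zero
  rw [h128, h64, h32, h16, h8]
  linear_combination (2 * x ^ 4 + x ^ 2 + x) * h2

/-- If `r` is coprime to `7`, zero is the only root of `x ^ 8 + x ^ 4 + x` in a characteristic two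
ring among the elements with `x ^ 2 ^ r = x`. -/
lemma eq_zero_of_x8_x4_x_eq_zero {R : Type*} [CommRing R] [CharP R 2] {r : ℕ}
    (h7 : ¬ 7 ∣ r) {x : R} (hr : x ^ 2 ^ r = x) (hx : x ^ 8 + x ^ 4 + x = 0) : x = 0 := by
  have hper (n : ℕ) : Function.IsPeriodicPt (fun y : R => y ^ 2) n x ↔ x ^ 2 ^ n = x := by
    rw [Function.IsPeriodicPt, Function.IsFixedPt, pow_iterate]
  have hgcd := ((hper 7).2 (by simpa using pow_128_eq_self_of_x8_x4_x_eq_zero hx)).gcd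
    ((hper r).2 hr)
  rw [((Nat.Prime.coprime_iff_not_dvd (by norm_num)).2 h7 : Nat.gcd 7 r = 1), hper,
    pow_one] at hgcd
  have h4 : x ^ 4 = x := by rw [show x ^ 4 = (x ^ 2) ^ 2 by ring, hgcd, hgcd]
  have h8 : x ^ 8 = x := by rw [show x ^ 8 = (x ^ 4) ^ 2 by ring, h4, hgcd]
  rwa [h8, h4, CharTwo.add_self_eq_zero, zero_add] at hx

theorem bijective_x8_x4_x (r : ℕ) (hr : 1 ≤ r) (h7 : ¬ (7 ∣ r)) :
    Function.Bijective (fun x : GaloisField 2 r => x ^ 8 + x ^ 4 + x) := by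
  refine Function.Injective.bijective_of_finite fun x y hxy => ?_
  have hpow (z : GaloisField 2 r) : z ^ 2 ^ r = z := by
    have := Fintype.ofFinite (GaloisField 2 r)
    rw [← GaloisField.card 2 r (by lia), Nat.card_eq_fintype_card, FiniteField.pow_card]
  refine sub_eq_zero.1 (eq_zero_of_x8_x4_x_eq_zero h7 (hpow _) ?_)
  have h4 : (x - y) ^ 4 = x ^ 4 - y ^ 4 := sub_pow_char_pow (p := 2) (n := 2) x y
  have h8 : (x - y) ^ 8 = x ^ 8 - y ^ 8 := sub_pow_char_pow (p := 2) (n := 3) x y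
  rw [h4, h8]
  linear_combination hxy
end

section
/- Let $r \geq 1$ and suppose $7 \nmid r$. Then the map $x \mapsto x^8 + x^2 + x$ is a bijection of the finite field $\mathbb{F}_{2^r}$ with $2^r$ elements. -/
/-- In characteristic two, `t ^ 3 + t + 1` divides `t ^ 7 - 1`, so zeros of the corresponding
linearized polynomial are fixed by the seventh power of Frobenius. -/
theorem pow_two_pow_seven_eq_self {R : Type*} [CommRing R] [CharP R 2] {x : R}
    (hx : x ^ 8 + x ^ 2 + x = 0) : x ^ 2 ^ 7 = x := by
  have key (k : ℕ) : (x ^ 8) ^ 2 ^ k + (x ^ 2) ^ 2 ^ k + x ^ 2 ^ k = 0 := by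
    rw [← add_pow_char_pow, ← add_pow_char_pow, hx, zero_pow (by positivity)]
  have h₁ := key 1
  have h₂ := key 2
  have h₄ := key 4
  have two : (2 : R) = 0 := CharTwo.two_eq_zero
  ring_nf at hx h₁ h₂ h₄ ⊢
  linear_combination hx + h₁ + h₂ + h₄ - (x + x ^ 2 + x ^ 4 + x ^ 8 + x ^ 16 + x ^ 32) * two

theorem eq_zero_of_pow_eight_add_sq_add_self {R : Type*} [CommRing R] [CharP R 2] {r : ℕ}
    (h7 : ¬ 7 ∣ r) {x : R} (hr : x ^ 2 ^ r = x) (hx : x ^ 8 + x ^ 2 + x = 0) : x = 0 := by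
  have periodic (n : ℕ) (h : x ^ 2 ^ n = x) : Function.IsPeriodicPt (frobenius R 2) n x := by
    rw [Function.IsPeriodicPt, Function.IsFixedPt, iterate_frobenius, h]
  have fixed := (periodic 7 (pow_two_pow_seven_eq_self hx)).gcd (periodic r hr)
  rw [(Nat.Prime.coprime_iff_not_dvd (by norm_num)).2 h7] at fixed
  have sq : x ^ 2 = x := fixed
  have pow_eight : x ^ 8 = x := by
    rw [show x ^ 8 = ((x ^ 2) ^ 2) ^ 2 by ring, sq, sq, sq]
  rwa [pow_eight, sq, CharTwo.add_self_eq_zero, zero_add] at hx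

theorem bijective_x8_x2_x (r : ℕ) (hr : 1 ≤ r) (h7 : ¬ (7 ∣ r)) :
    Function.Bijective (fun x : GaloisField 2 r => x ^ 8 + x ^ 2 + x) := by
  refine Finite.injective_iff_bijective.1 fun x y hxy => ?_
  have frob (z : GaloisField 2 r) : z ^ 2 ^ r = z := by
    have := Fintype.ofFinite (GaloisField 2 r)
    rw [← GaloisField.card 2 r (by omega), Nat.card_eq_fintype_card, FiniteField.pow_card]
  refine sub_eq_zero.1 (eq_zero_of_pow_eight_add_sq_add_self h7 (frob (x - y)) ?_)
  have h_eight := sub_pow_char_pow (p := 2) x y 3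
  norm_num at h_eight
  rw [h_eight, sub_pow_char]
  linear_combination hxy
end

section
/- Let $r \geq 1$ with $3 \mid r$. Then the map $x \mapsto x^4 + x^2 + x$ on the finite field $\mathbb{F}_{2^r}$ with $2^r$ elements is not injective. -/
theorem exists_ne_one_pow_seven_eq_one (r : ℕ) (hr : 1 ≤ r) (h3 : 3 ∣ r) :
    ∃ z : GaloisField 2 r, z ≠ 1 ∧ z ^ 7 = 1 := by
  classical
  have : Fact (Nat.Prime 7) := ⟨by norm_num⟩
  have hcard : 7 ∣ Nat.card (GaloisField 2 r)ˣ := by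
    rw [Nat.card_units, GaloisField.card 2 r (by omega)]
    obtain ⟨k, rfl⟩ := h3
    rw [pow_mul]
    simpa using Nat.sub_dvd_pow_sub_pow 8 1 k
  obtain ⟨u, hu⟩ := exists_prime_orderOf_dvd_card' 7 hcard
  refine ⟨u, fun h => ?_, ?_⟩
  · rw [Units.val_eq_one.mp h, orderOf_one] at hu
    omega
  · rw [← Units.val_pow_eq_pow_val, ← hu, pow_orderOf_eq_one, Units.val_one]

theorem not_injective_x4_x2_x (r : ℕ) (hr : 1 ≤ r) (h3 : 3 ∣ r) :
    ¬ Function.Injective (fun x : GaloisField 2 r => x ^ 4 + x ^ 2 + x) := by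
  intro hinj
  have hroot : ∀ x : GaloisField 2 r, x ^ 3 + x + 1 = 0 → False := by
    intro x hx
    have h0 : x = 0 := hinj (by linear_combination x * hx)
    simp [h0] at hx
  obtain ⟨z, hz1, hz⟩ := exists_ne_one_pow_seven_eq_one r hr h3
  have h2 : (2 : GaloisField 2 r) = 0 := CharTwo.two_eq_zero
  have hfac : (z - 1) * ((z ^ 3 + z + 1) * (z ^ 3 + z ^ 2 + 1)) = 0 := by
    linear_combination hz + (z ^ 4 - z ^ 3) * h2
  rcases mul_eq_zero.mp hfac with h | h
  · exact hz1 (sub_eq_zero.mp h)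
  rcases mul_eq_zero.mp h with h | h
  · exact hroot z h
  · have hz0 : z ≠ 0 := by
      rintro rfl
      simp at hz
    refine hroot z⁻¹ ?_
    field_simp
    linear_combination h
end

section
/- Let $r \geq 1$ with $7 \mid r$. Then neither the map $x \mapsto x^8 + x^4 + x$ nor the map $x \mapsto x^8 + x^2 + x$ on the finite field $\mathbb{F}_{2^r}$ with $2^r$ elements is injective. -/
open Polynomial in
/-- A polynomial over a finite field of order `q` of positive degree has a root in the field as soon
as its canonical root in `AdjoinRoot` is fixed by `x ↦ x ^ q`. -/
theorem FiniteField.exists_isRoot_of_root_pow_card {K : Type*} [Field K] [Finite K] {f : K[X]}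
    (hdeg : f.degree ≠ 0)
    (hroot : AdjoinRoot.root f ^ Nat.card K = AdjoinRoot.root f) : ∃ x, f.IsRoot x := by
  have hdvd : f ∣ X ^ Nat.card K - X := by
    rw [← AdjoinRoot.mk_eq_zero, map_sub, map_pow, AdjoinRoot.mk_X, hroot, sub_self]
  exact ((Polynomial.splits_X_pow_nat_card_sub_X (K := K)).of_dvd
    (FiniteField.X_pow_card_sub_X_ne_zero K Finite.one_lt_card) hdvd).exists_eval_eq_zero hdeg

theorem pow_two_pow_eq_self_of_dvd {M : Type*} [Monoid M] {a : M} {n r : ℕ}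
    (ha : a ^ 2 ^ n = a) (h : n ∣ r) : a ^ 2 ^ r = a := by
  obtain ⟨m, rfl⟩ := h
  induction m with
  | zero => simp
  | succ m ih => rw [Nat.mul_succ, pow_add, pow_mul, ih, ha]

theorem pow_128_eq_self_of_pow_seven_add_pow_three {A : Type*} [CommRing A] [CharP A 2] {a : A}
    (h : a ^ 7 + a ^ 3 + 1 = 0) : a ^ 2 ^ 7 = a := by
  have h2 : (2 : A) = 0 := CharTwo.two_eq_zero
  have h8 : a ^ 8 = a ^ 4 + a := by linear_combination a * h - (a ^ 4 + a) * h2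
  have h16 : a ^ 16 = a ^ 4 + a ^ 2 + a := by
    linear_combination (a ^ 8 + a ^ 4 + a + 1) * h8 + a ^ 5 * h2
  have h32 : a ^ 32 = a ^ 2 + a := by
    linear_combination (a ^ 16 + a ^ 4 + a ^ 2 + a) * h16 + h8 + (a ^ 6 + a ^ 5 + a ^ 3 + a ^ 4) * h2
  have h64 : a ^ 64 = a ^ 4 + a ^ 2 := by
    linear_combination (a ^ 32 + a ^ 2 + a) * h32 + a ^ 3 * h2
  linear_combination (a ^ 64 + a ^ 4 + a ^ 2) * h64 + h8 + (a ^ 6 + a ^ 4) * h2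

theorem pow_128_eq_self_of_pow_seven_add_self {A : Type*} [CommRing A] [CharP A 2] {a : A}
    (h : a ^ 7 + a + 1 = 0) : a ^ 2 ^ 7 = a := by
  have h2 : (2 : A) = 0 := CharTwo.two_eq_zero
  have h8 : a ^ 8 = a ^ 2 + a := by linear_combination a * h - (a ^ 2 + a) * h2
  have h16 : a ^ 16 = a ^ 4 + a ^ 2 := by
    linear_combination (a ^ 8 + a ^ 2 + a) * h8 + a ^ 3 * h2
  have h32 : a ^ 32 = a ^ 4 + a ^ 2 + a := by
    linear_combination (a ^ 16 + a ^ 4 + a ^ 2) * h16 + h8 + a ^ 6 * h2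
  have h64 : a ^ 64 = a ^ 4 + a := by
    linear_combination (a ^ 32 + a ^ 4 + a ^ 2 + a) * h32 + h8 +
      (a ^ 6 + a ^ 5 + a ^ 3 + a ^ 2) * h2
  linear_combination (a ^ 64 + a ^ 4 + a) * h64 + h8 + (a ^ 5 + a ^ 2) * h2

open Polynomial in
theorem not_injective_x8_x4_x_and_x8_x2_x (r : ℕ) (hr : 1 ≤ r) (h7 : 7 ∣ r) :
    ¬ Function.Injective (fun x : GaloisField 2 r => x ^ 8 + x ^ 4 + x) ∧
    ¬ Function.Injective (fun x : GaloisField 2 r => x ^ 8 + x ^ 2 + x) := by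
  have hcard : Nat.card (GaloisField 2 r) = 2 ^ r := GaloisField.card 2 r (by lia)
  constructor
  · intro hinj
    let f : (GaloisField 2 r)[X] := X ^ 7 + X ^ 3 + 1
    have hdeg : f.degree = 7 := by unfold f; compute_degree!
    have : Nontrivial (AdjoinRoot f) := AdjoinRoot.nontrivial f (by simp [hdeg])
    have : CharP (AdjoinRoot f) 2 := charP_of_injective_algebraMap
      (algebraMap (GaloisField 2 r) (AdjoinRoot f)).injective 2
    have hroot : AdjoinRoot.root f ^ 7 + AdjoinRoot.root f ^ 3 + 1 = 0 := by
      simpa [f] using AdjoinRoot.eval₂_root f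
    obtain ⟨x, hx⟩ := FiniteField.exists_isRoot_of_root_pow_card (f := f) (by simp [hdeg]) (by
      rw [hcard]
      exact pow_two_pow_eq_self_of_dvd (pow_128_eq_self_of_pow_seven_add_pow_three hroot) h7)
    replace hx : x ^ 7 + x ^ 3 + 1 = 0 := by simpa [f] using hx
    have hx0 : x = 0 := hinj (by linear_combination x * hx)
    simp [hx0] at hx
  · intro hinj
    let f : (GaloisField 2 r)[X] := X ^ 7 + X + 1
    have hdeg : f.degree = 7 := by unfold f; compute_degree!
    have : Nontrivial (AdjoinRoot f) := AdjoinRoot.nontrivial f (by simp [hdeg])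
    have : CharP (AdjoinRoot f) 2 := charP_of_injective_algebraMap
      (algebraMap (GaloisField 2 r) (AdjoinRoot f)).injective 2
    have hroot : AdjoinRoot.root f ^ 7 + AdjoinRoot.root f + 1 = 0 := by
      simpa [f] using AdjoinRoot.eval₂_root f
    obtain ⟨x, hx⟩ := FiniteField.exists_isRoot_of_root_pow_card (f := f) (by simp [hdeg]) (by
      rw [hcard]
      exact pow_two_pow_eq_self_of_dvd (pow_128_eq_self_of_pow_seven_add_self hroot) h7)
    replace hx : x ^ 7 + x + 1 = 0 := by simpa [f] using hx
    have hx0 : x = 0 := hinj (by linear_combination x * hx)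
    simp [hx0] at hx
end

section
/- Let $k$ be a field and let $P, Q \in k[X]$ be univariate polynomials. Let $F = (P(X_1), X_2, X_3)$ and $G = (Q(X_1), X_2, X_3)$ as polynomial endomorphisms of $k^3$. Suppose $F$ and $G$ are equivalent, i.e., there exist polynomial automorphisms $S, T$ of $k^3$ with $S \circ F = G \circ T$. Then there exist $a, b, c \in k$ with $a \neq 0$ and $c \neq 0$ such that $Q'(aX + b) = c \cdot P'(X)$ in $k[X]$, where $P', Q'$ denote the derivatives of $P$ and $Q$. -/
open MvPolynomial

/-- A polynomial endomorphism is an automorphism if it has a two-sided compositional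
inverse. -/
def IsPolyAut {k : Type*} [Field k] {n : ℕ}
    (F : Fin n → MvPolynomial (Fin n) k) : Prop :=
  ∃ G : Fin n → MvPolynomial (Fin n) k,
    (∀ i, aeval G (F i) = X i) ∧ (∀ i, aeval F (G i) = X i)

/-- The Jacobian matrix of a polynomial endomorphism. -/
noncomputable def jacobianMatrix {k : Type*} [CommRing k] {n : ℕ}
    (F : Fin n → MvPolynomial (Fin n) k) : Matrix (Fin n) (Fin n) (MvPolynomial (Fin n) k) :=
  Matrix.of fun i j => pderiv j (F i)

/-- The chain rule for partial derivatives of polynomials. -/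
theorem pderiv_aeval_eq_sum {k : Type*} [CommRing k] {n : ℕ} (j : Fin n)
    (G : Fin n → MvPolynomial (Fin n) k) (p : MvPolynomial (Fin n) k) :
    pderiv j (aeval G p) = ∑ l, aeval G (pderiv l p) * pderiv j (G l) := by
  induction p using MvPolynomial.induction_on with
  | C a => simp
  | add p q hp hq => simp only [map_add, hp, hq, add_mul, Finset.sum_add_distrib]
  | mul_X p i hp =>
    have h : ∀ l : Fin n, aeval G (pderiv l (p * X i)) * pderiv j (G l) =
        aeval G p * (if l = i then pderiv j (G l) else 0) +
          G i * (aeval G (pderiv l p) * pderiv j (G l)) := by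
      intro l
      rw [pderiv_mul, pderiv_X, map_add, map_mul, map_mul, aeval_X]
      by_cases hl : l = i
      · subst hl
        simp
        ring
      · simp [hl, Ne.symm hl]
        ring
    simp only [h, Finset.sum_add_distrib, ← Finset.mul_sum, ← hp]
    simp

theorem det_jacobianMatrix_aeval {k : Type*} [CommRing k] {n : ℕ}
    (F G : Fin n → MvPolynomial (Fin n) k) :
    (jacobianMatrix fun i => aeval G (F i)).det =
      aeval G (jacobianMatrix F).det * (jacobianMatrix G).det := by
  rw [AlgHom.map_det, ← Matrix.det_mul]
  congr 1
  ext1 i j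
  simp only [jacobianMatrix, Matrix.mul_apply, Matrix.of_apply, AlgHom.mapMatrix_apply,
    Matrix.map_apply, pderiv_aeval_eq_sum]

theorem IsPolyAut.isUnit_det_jacobianMatrix {k : Type*} [Field k] {n : ℕ}
    {F : Fin n → MvPolynomial (Fin n) k} (hF : IsPolyAut F) :
    IsUnit (jacobianMatrix F).det := by
  obtain ⟨G, -, h⟩ := hF
  have hone : (jacobianMatrix fun i : Fin n => (X i : MvPolynomial (Fin n) k)).det = 1 := by
    rw [← Matrix.det_one (n := Fin n)]
    congr 1
    ext1 i j
    simp [jacobianMatrix, pderiv_X, Matrix.one_apply, Pi.single_apply]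
  have key := det_jacobianMatrix_aeval G F
  simp only [h, hone] at key
  exact IsUnit.of_mul_eq_one_right _ key.symm

theorem det_jacobianMatrix_univariate {k : Type*} [CommRing k] (P : Polynomial k) :
    (jacobianMatrix
      ![Polynomial.aeval (X 0 : MvPolynomial (Fin 3) k) P, X 1, X 2]).det =
      Polynomial.aeval (X 0) (Polynomial.derivative P) := by
  rw [Matrix.det_fin_three]
  simp [jacobianMatrix, Derivation.map_aeval, pderiv_X]

theorem totalDegree_aeval_of_totalDegree_pos {k σ : Type*} [Field k] {f : MvPolynomial σ k}
    (hf : 0 < f.totalDegree) (q : Polynomial k) (hq : q ≠ 0) :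
    Polynomial.aeval f q ≠ 0 ∧
      (Polynomial.aeval f q).totalDegree = q.natDegree * f.totalDegree := by
  induction hn : q.natDegree generalizing q with
  | zero =>
    obtain ⟨r, rfl⟩ := Polynomial.natDegree_eq_zero.mp hn
    have hr : r ≠ 0 := by simpa using hq
    simp [algebraMap_eq, hr]
  | succ n ih =>
    have hdeg : q.divX.natDegree = n := by
      rw [Polynomial.natDegree_divX_eq_natDegree_tsub_one, hn, Nat.add_sub_cancel]
    have hdiv : q.divX ≠ 0 := by
      intro h
      rw [Polynomial.divX_eq_zero_iff] at h
      rw [h, Polynomial.natDegree_C] at hn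
      omega
    obtain ⟨h0, hd⟩ := ih q.divX hdiv hdeg
    have hf0 : f ≠ 0 := by
      rintro rfl
      simp at hf
    have hmul : (Polynomial.aeval f q.divX * f).totalDegree = (n + 1) * f.totalDegree := by
      rw [totalDegree_mul_of_isDomain h0 hf0, hd]
      ring
    have hpos : 0 < (n + 1) * f.totalDegree := by positivity
    have htot : (Polynomial.aeval f q).totalDegree = (n + 1) * f.totalDegree := by
      conv_lhs => rw [← Polynomial.divX_mul_X_add q]
      rw [map_add, map_mul, Polynomial.aeval_X, Polynomial.aeval_C, algebraMap_eq,
        totalDegree_add_eq_left_of_totalDegree_lt, hmul]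
      rwa [totalDegree_C, hmul]
    refine ⟨fun h => ?_, htot⟩
    rw [h, totalDegree_zero] at htot
    omega

theorem totalDegree_polynomial_aeval {k σ : Type*} [Field k] (f : MvPolynomial σ k)
    (q : Polynomial k) :
    (Polynomial.aeval f q).totalDegree = q.natDegree * f.totalDegree := by
  rcases eq_or_ne q 0 with rfl | hq
  · simp
  rcases Nat.eq_zero_or_pos f.totalDegree with hf | hf
  · rw [hf, mul_zero]
    rw [totalDegree_eq_zero_iff_eq_C] at hf
    rw [hf, ← algebraMap_eq, Polynomial.aeval_algebraMap_apply, algebraMap_eq, totalDegree_C]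
  · exact (totalDegree_aeval_of_totalDegree_pos hf q hq).2

theorem equivalent_univariate_derivatives
    {k : Type*} [Field k] (P Q : Polynomial k)
    (F G : Fin 3 → MvPolynomial (Fin 3) k)
    (hF : F = ![Polynomial.aeval (X 0 : MvPolynomial (Fin 3) k) P, X 1, X 2])
    (hG : G = ![Polynomial.aeval (X 0 : MvPolynomial (Fin 3) k) Q, X 1, X 2])
    (hequiv : ∃ S T : Fin 3 → MvPolynomial (Fin 3) k,
      IsPolyAut S ∧ IsPolyAut T ∧ endoComp S F = endoComp G T) :
    ∃ a b c : k, a ≠ 0 ∧ c ≠ 0 ∧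
      (Polynomial.derivative Q).comp (Polynomial.C a * Polynomial.X + Polynomial.C b) =
        Polynomial.C c * Polynomial.derivative P := by
  obtain ⟨S, T, hS, hT, hST⟩ := hequiv
  subst hF hG
  obtain ⟨c, hc, hder⟩ : ∃ c : k, c ≠ 0 ∧
      Polynomial.aeval (T 0) (Polynomial.derivative Q) =
        Polynomial.aeval (X 0) (Polynomial.C c * Polynomial.derivative P) := by
    obtain ⟨s, hs, hsdet⟩ := isUnit_iff_eq_C_of_isReduced.mp hS.isUnit_det_jacobianMatrix
    obtain ⟨t, ht, htdet⟩ := isUnit_iff_eq_C_of_isReduced.mp hT.isUnit_det_jacobianMatrix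
    have key : (jacobianMatrix fun i => aeval _ (S i)).det =
      (jacobianMatrix fun i => aeval T ((_ : Fin 3 → MvPolynomial (Fin 3) k) i)).det :=
      congrArg (fun H => (jacobianMatrix H).det) hST
    simp only [det_jacobianMatrix_aeval, det_jacobianMatrix_univariate, hsdet, htdet,
      algHom_C, algebraMap_eq, ← Polynomial.aeval_algHom_apply, aeval_X] at key
    refine ⟨t⁻¹ * s, mul_ne_zero (inv_ne_zero ht.ne_zero) hs.ne_zero, ?_⟩
    have hCt : (C t⁻¹ * C t : MvPolynomial (Fin 3) k) = 1 := by
      rw [← C_mul, inv_mul_cancel₀ ht.ne_zero, C_1]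
    rw [map_mul, Polynomial.aeval_C, algebraMap_eq, C_mul, mul_assoc, key, mul_left_comm, hCt,
      mul_one]
  obtain ⟨U, hU, -⟩ := hT
  have hcomp : (Polynomial.derivative Q).comp
      (aeval ![(Polynomial.X : Polynomial k), 0, 0] (T 0)) =
        Polynomial.C c * Polynomial.derivative P := by
    have h := congrArg (aeval ![(Polynomial.X : Polynomial k), 0, 0]) hder
    simpa only [← Polynomial.aeval_algHom_apply, aeval_X, Matrix.cons_val_zero,
      ← Polynomial.comp_eq_aeval, Polynomial.comp_X] using h
  rcases Nat.eq_zero_or_pos (Polynomial.derivative Q).natDegree with hQ | hQ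
  · refine ⟨1, 0, c, one_ne_zero, hc, ?_⟩
    obtain ⟨d, hd⟩ := Polynomial.natDegree_eq_zero.mp hQ
    rw [← hcomp, ← hd, Polynomial.C_comp, Polynomial.C_comp]
  have hdeg : (Polynomial.derivative Q).natDegree * (T 0).totalDegree =
      (Polynomial.C c * Polynomial.derivative P).natDegree := by
    have h := congrArg totalDegree hder
    rwa [totalDegree_polynomial_aeval, totalDegree_polynomial_aeval, totalDegree_X, mul_one] at h
  have hdeg' : (Polynomial.derivative Q).natDegree =
      (Polynomial.C c * Polynomial.derivative P).natDegree * (U 0).totalDegree := by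
    have h := congrArg (fun p => (aeval U p).totalDegree) hder
    simpa only [← Polynomial.aeval_algHom_apply, aeval_X, hU, totalDegree_polynomial_aeval,
      totalDegree_X, mul_one] using h
  have hT1 : (T 0).totalDegree = 1 := by
    rw [← hdeg, mul_assoc] at hdeg'
    exact Nat.eq_one_of_mul_eq_one_right (Nat.eq_of_mul_eq_mul_left hQ ((mul_one _).trans hdeg').symm)
  have hlin : (aeval ![(Polynomial.X : Polynomial k), 0, 0] (T 0)).natDegree ≤ 1 := by
    refine (aeval_natDegree_le (T 0) hT1.le _ (n := 1) fun i => ?_).trans_eq (one_mul 1)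
    fin_cases i <;> simp
  obtain ⟨a, b, hab⟩ := Polynomial.exists_eq_X_add_C_of_natDegree_le_one hlin
  rw [hab] at hcomp
  refine ⟨a, b, c, ?_, hc, hcomp⟩
  rintro rfl
  have h := congrArg Polynomial.natDegree hcomp
  rw [Polynomial.natDegree_comp, ← hdeg, hT1] at h
  simp at h
  omega
end

section
/- Let $r \geq 1$ with $7 \nmid r$, and let $K = \mathbb{F}_{2^r}$ be the finite field with $2^r$ elements. Then the map $K^3 \to K^3$ given by $(x, y, z) \mapsto (x + y^2, \; y + x^2 + z^2, \; z + x^2)$ is bijective. -/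
/-- In a field of order `2 ^ r` with `7 ∤ r`, the only solution of `y = y ^ 4 + y ^ 8` is zero:
any solution is fixed by the seventh power of Frobenius, hence by Frobenius itself. -/
theorem eq_zero_of_eq_pow_four_add_pow_eight {K : Type*} [Field K] [CharP K 2] {r : ℕ}
    (hcard : ∀ y : K, y ^ 2 ^ r = y) (h7 : ¬ 7 ∣ r) {y : K} (hy : y = y ^ 4 + y ^ 8) : y = 0 := by
  have h2 : (2 : K) = 0 := CharTwo.two_eq_zero
  have h8 : y ^ 8 = y + y ^ 4 := by linear_combination -hy - y ^ 4 * h2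
  have h16 : y ^ 16 = y + y ^ 2 + y ^ 4 := by
    have : y ^ 16 = (y ^ 8) ^ 2 := by ring
    rw [this, h8, CharTwo.add_sq, ← pow_mul, h8]
    ring
  have h32 : y ^ 32 = y + y ^ 2 := by
    have : y ^ 32 = (y ^ 16) ^ 2 := by ring
    rw [this, h16, CharTwo.add_sq, CharTwo.add_sq, ← pow_mul, ← pow_mul, h8]
    linear_combination y ^ 4 * h2
  have h128 : y ^ 2 ^ 7 = y := by
    have : y ^ 2 ^ 7 = (y ^ 32) ^ 4 := by ring
    rw [this, h32, show (y + y ^ 2) ^ 4 = ((y + y ^ 2) ^ 2) ^ 2 by ring, CharTwo.add_sq,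
      CharTwo.add_sq]
    linear_combination -hy
  have periodic : ∀ n : ℕ, y ^ 2 ^ n = y → Function.IsPeriodicPt (frobenius K 2) n y := by
    intro n hn
    rw [Function.IsPeriodicPt, Function.IsFixedPt, iterate_frobenius, hn]
  have hgcd := (periodic 7 h128).gcd (periodic r (hcard y))
  rw [(Nat.Prime.coprime_iff_not_dvd (by norm_num)).2 h7] at hgcd
  have hsq : y ^ 2 = y := hgcd
  have h4 : y ^ 4 = y := by rw [show y ^ 4 = (y ^ 2) ^ 2 by ring, hsq, hsq]
  rw [show y ^ 8 = (y ^ 4) ^ 2 by ring, h4, hsq] at h8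
  linear_combination -h8

theorem bijective_triple_map (r : ℕ) (hr : 1 ≤ r) (h7 : ¬ (7 ∣ r)) :
    Function.Bijective (fun p : Fin 3 → GaloisField 2 r =>
      ![p 0 + (p 1) ^ 2, p 1 + (p 0) ^ 2 + (p 2) ^ 2, p 2 + (p 0) ^ 2]) := by
  have hcard : ∀ y : GaloisField 2 r, y ^ 2 ^ r = y := fun y => by
    have := Fintype.ofFinite (GaloisField 2 r)
    rw [← GaloisField.card 2 r (by omega), Nat.card_eq_fintype_card, FiniteField.pow_card]
  have h2 : (2 : GaloisField 2 r) = 0 := CharTwo.two_eq_zero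
  refine Finite.injective_iff_bijective.1 fun p q hpq => ?_
  have e0 : p 0 + p 1 ^ 2 = q 0 + q 1 ^ 2 := congrFun hpq 0
  have e1 : p 1 + p 0 ^ 2 + p 2 ^ 2 = q 1 + q 0 ^ 2 + q 2 ^ 2 := congrFun hpq 1
  have e2 : p 2 + p 0 ^ 2 = q 2 + q 0 ^ 2 := congrFun hpq 2
  have sub_sq (a b : GaloisField 2 r) : (a - b) ^ 2 = a ^ 2 - b ^ 2 := sub_pow_char a b (p := 2)
  have hx : p 0 - q 0 = (p 1 - q 1) ^ 2 := by
    rw [sub_sq]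
    linear_combination e0 - (p 1 ^ 2 - q 1 ^ 2) * h2
  have hz : p 2 - q 2 = (p 0 - q 0) ^ 2 := by
    rw [sub_sq]
    linear_combination e2 - (p 0 ^ 2 - q 0 ^ 2) * h2
  have hy : p 1 - q 1 = (p 0 - q 0) ^ 2 + (p 2 - q 2) ^ 2 := by
    rw [sub_sq, sub_sq]
    linear_combination e1 - (p 0 ^ 2 - q 0 ^ 2 + (p 2 ^ 2 - q 2 ^ 2)) * h2
  have hy0 : p 1 - q 1 = 0 := by
    refine eq_zero_of_eq_pow_four_add_pow_eight hcard h7 ?_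
    rw [hz, hx, ← pow_mul, ← pow_mul] at hy
    exact hy
  rw [hy0] at hx
  rw [hx] at hz
  ext i
  fin_cases i
  · exact sub_eq_zero.1 (by simpa using hx)
  · exact sub_eq_zero.1 hy0
  · exact sub_eq_zero.1 (by simpa using hz)
end

section
/- Let $k = \mathbb{F}_2$ be the field with two elements and let $F = (X_1 + X_2^2, \; X_2 + X_1^2 + X_3^2, \; X_3 + X_1^2)$ be the polynomial endomorphism of $k^3$. Then $F$ is a mock automorphism of $\mathbb{F}_2^3$: the induced map $\mathbb{F}_2^3 \to \mathbb{F}_2^3$ is bijective and the determinant of the Jacobian matrix of $F$ equals the constant polynomial $1$; nevertheless, $F$ is not a polynomial automorphism of $k^3$. -/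
open MvPolynomial

theorem exists_pow_seven_add_pow_three_add_one_eq_zero (K : Type*) [Field K] [IsAlgClosed K] :
    ∃ y : K, y ^ 7 + y ^ 3 + 1 = 0 := by
  have hdeg : (Polynomial.X ^ 7 + Polynomial.X ^ 3 + 1 : Polynomial K).degree = 7 := by
    compute_degree!
  obtain ⟨y, hy⟩ := IsAlgClosed.exists_root
    (Polynomial.X ^ 7 + Polynomial.X ^ 3 + 1 : Polynomial K) (by rw [hdeg]; decide)
  exact ⟨y, by simpa using hy⟩

/-- A polynomial map with a polynomial left inverse is injective on the points of every algebra. -/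
theorem injective_aeval_of_leftInverse {σ R A : Type*} [CommSemiring R] [CommSemiring A]
    [Algebra R A] {F G : σ → MvPolynomial σ R} (h : ∀ i, aeval F (G i) = X i) :
    Function.Injective (fun (a : σ → A) i => aeval a (F i)) := by
  have key (a : σ → A) (i : σ) : aeval (fun j => aeval a (F j)) (G i) = a i := by
    rw [← comp_aeval_apply, h, aeval_X]
  intro a b hab
  funext i
  rw [← key a, ← key b]
  exact congrArg (fun c => aeval c (G i)) hab

theorem mock_automorphism_not_automorphism_F2
    (F : Fin 3 → MvPolynomial (Fin 3) (ZMod 2))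
    (hF : F = ![X 0 + X 1 ^ 2, X 1 + X 0 ^ 2 + X 2 ^ 2, X 2 + X 0 ^ 2]) :
    Function.Bijective (fun a : Fin 3 → ZMod 2 => fun i => eval a (F i)) ∧
    Matrix.det (Matrix.of fun i j => pderiv j (F i)) = 1 ∧
    ¬ ∃ G : Fin 3 → MvPolynomial (Fin 3) (ZMod 2),
        (∀ i, aeval G (F i) = X i) ∧ (∀ i, aeval F (G i) = X i) := by
  subst hF
  refine ⟨?_, ?_, ?_⟩
  · have heval : (fun a : Fin 3 → ZMod 2 => fun i => eval a
        ((![X 0 + X 1 ^ 2, X 1 + X 0 ^ 2 + X 2 ^ 2, X 2 + X 0 ^ 2] :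
          Fin 3 → MvPolynomial (Fin 3) (ZMod 2)) i)) =
        fun a => ![a 0 + a 1 ^ 2, a 1 + a 0 ^ 2 + a 2 ^ 2, a 2 + a 0 ^ 2] := by
      funext a i
      fin_cases i <;> simp
    rw [heval, ← Finite.injective_iff_bijective]
    decide
  · have h2 : (2 : MvPolynomial (Fin 3) (ZMod 2)) = 0 := CharTwo.two_eq_zero
    simp [Matrix.det_fin_three, pderiv_X, h2]
  · rintro ⟨G, -, hG⟩
    obtain ⟨y, hy⟩ :=
      exists_pow_seven_add_pow_three_add_one_eq_zero (AlgebraicClosure (ZMod 2))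
    have h2 : (2 : AlgebraicClosure (ZMod 2)) = 0 := CharTwo.two_eq_zero
    have hker : ![y ^ 2, y, y ^ 4] = 0 := by
      apply injective_aeval_of_leftInverse hG
      funext i
      fin_cases i
      · simp
        linear_combination y ^ 2 * h2
      · simp
        linear_combination y * hy
      · simp
        linear_combination y ^ 4 * h2
    have hy0 : y = 0 := congrFun hker 1
    simp [hy0] at hy
end

section
/- Let $k = \mathbb{F}_2$ be the field with two elements and let $F = (X_1 + X_2^2 X_3, \; X_2 + X_1^2 X_3 + X_2^2 X_3, \; X_3 + X_1^3 + X_1 X_2^2 + X_2^3)$ be the polynomial endomorphism of $k^3$. Then: (1) $F$ is a mock automorphism of $\mathbb{F}_2^3$, i.e., the induced map $\mathbb{F}_2^3 \to \mathbb{F}_2^3$ is bijective and the determinant of the Jacobian matrix of $F$ is a nonzero constant polynomial; and (2) $F$ does not satisfy the dependence criterion, i.e., the nonlinear parts $H_1 = X_2^2 X_3$, $H_2 = X_1^2 X_3 + X_2^2 X_3$, $H_3 = X_1^3 + X_1 X_2^2 + X_2^3$ are linearly independent over $\mathbb{F}_2$. -/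
open MvPolynomial

theorem mock_automorphism_independent_nonlinear_parts_F2
    (F : Fin 3 → MvPolynomial (Fin 3) (ZMod 2))
    (hF : F = ![X 0 + X 1 ^ 2 * X 2,
                X 1 + X 0 ^ 2 * X 2 + X 1 ^ 2 * X 2,
                X 2 + X 0 ^ 3 + X 0 * X 1 ^ 2 + X 1 ^ 3]) :
    Function.Bijective (fun a : Fin 3 → ZMod 2 => fun i => eval a (F i)) ∧
    (∃ c : ZMod 2, c ≠ 0 ∧
      Matrix.det (Matrix.of fun i j => pderiv j (F i)) = C c) ∧
    LinearIndependent (ZMod 2)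
      ![(X 1 ^ 2 * X 2 : MvPolynomial (Fin 3) (ZMod 2)),
        X 0 ^ 2 * X 2 + X 1 ^ 2 * X 2,
        X 0 ^ 3 + X 0 * X 1 ^ 2 + X 1 ^ 3] := by
  subst hF
  refine ⟨?_, ⟨1, one_ne_zero, ?_⟩, ?_⟩
  · have h : (fun a : Fin 3 → ZMod 2 => fun i => eval a
        ((![X 0 + X 1 ^ 2 * X 2, X 1 + X 0 ^ 2 * X 2 + X 1 ^ 2 * X 2,
          X 2 + X 0 ^ 3 + X 0 * X 1 ^ 2 + X 1 ^ 3] :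
            Fin 3 → MvPolynomial (Fin 3) (ZMod 2)) i)) =
        fun a => ![a 0 + a 1 ^ 2 * a 2, a 1 + a 0 ^ 2 * a 2 + a 1 ^ 2 * a 2,
          a 2 + a 0 ^ 3 + a 0 * a 1 ^ 2 + a 1 ^ 3] := by
      funext a i
      fin_cases i <;> simp
    rw [h, ← Finite.injective_iff_bijective]
    unfold Function.Injective
    decide +kernel
  · have h2 : (2 : MvPolynomial (Fin 3) (ZMod 2)) = 0 := CharTwo.two_eq_zero
    simp [Matrix.det_fin_three, pderiv_X, Derivation.leibniz_pow]
    grind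
  · rw [Fintype.linearIndependent_iff]
    intro g hg
    have e (a : Fin 3 → ZMod 2) := congrArg (eval a) hg
    have e₁ := e ![0, 1, 1]
    have e₂ := e ![1, 0, 0]
    have e₃ := e ![1, 0, 1]
    simp [Fin.sum_univ_three, smul_eval] at e₁ e₂ e₃
    intro i
    fin_cases i <;> grind
end
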